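/- Let v_1, ..., v_s ∈ ℝ^n be vectors that span ℝ^n, and suppose there exist strictly positive reals a_1, ..., a_s with Σ_i a_i v_i = 0. Then for any c_1, ..., c_s ∈ ℝ, the set {x ∈ ℝ^n : ⟨x, v_i⟩ ≥ c_i for all i} is compact. -/

import Mathlib

open Finset RealInnerProductSpace

/-- Let `v_1, …, v_s ∈ ℝ^n` span `ℝ^n`, and suppose there exist strictly positive
reals `a_1, …, a_s` with `Σ_i a_i v_i = 0`. Then for any `c_1, …, c_s ∈ ℝ` the set
`{x ∈ ℝ^n : ⟨x, v_i⟩ ≥ c_i for all i}` is compact. -/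
theorem compact_polytope_criterion (n s : ℕ) (v : Fin s → EuclideanSpace ℝ (Fin n))
    (hspan : Submodule.span ℝ (Set.range v) = ⊤)
    (a : Fin s → ℝ) (ha : ∀ i, 0 < a i) (hrel : ∑ i, a i • v i = 0)
    (c : Fin s → ℝ) :
    IsCompact {x : EuclideanSpace ℝ (Fin n) | ∀ i, c i ≤ ⟪x, v i⟫} := by
  let L : EuclideanSpace ℝ (Fin n) →ₗ[ℝ] (Fin s → ℝ) :=
    LinearMap.pi fun i => (innerₛₗ ℝ (v i))
  have hL : ∀ x i, L x i = ⟪x, v i⟫ := by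
    intro x i
    simp [L, real_inner_comm]
  have hker : LinearMap.ker L = ⊥ := by
    rw [LinearMap.ker_eq_bot']
    intro x hx
    have h1 : ∀ y ∈ Submodule.span ℝ (Set.range v), ⟪x, y⟫ = 0 := by
      intro y hy
      induction hy using Submodule.span_induction with
      | mem y hy =>
        obtain ⟨i, rfl⟩ := hy
        rw [← hL, hx]; rfl
      | zero => simp
      | add y z _ _ hy hz => rw [inner_add_right, hy, hz, add_zero]
      | smul r y _ hy => rw [real_inner_smul_right, hy, mul_zero]
    have h2 := h1 x (by rw [hspan]; trivial)
    exact inner_self_eq_zero.mp h2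
  have hemb := LinearMap.isClosedEmbedding_of_injective hker
  have hK := hemb.isCompact_preimage
    (isCompact_Icc (a := c) (b := fun i => c i + (-∑ j, a j * c j) / a i))
  convert hK using 1
  ext x
  simp only [Set.mem_setOf_eq, Set.mem_preimage, Set.mem_Icc, Pi.le_def, hL]
  refine ⟨fun h => ⟨h, fun i => ?_⟩, fun h => h.1⟩
  have h0 : ∑ j, a j * ⟪x, v j⟫ = 0 := by
    have : ⟪x, ∑ j, a j • v j⟫ = 0 := by rw [hrel, inner_zero_right]
    simpa [inner_sum, real_inner_smul_right] using this
  have h3 : a i * (⟪x, v i⟫ - c i) ≤ ∑ j, a j * (⟪x, v j⟫ - c j) :=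
    Finset.single_le_sum (f := fun j => a j * (⟪x, v j⟫ - c j))
      (fun j _ => mul_nonneg (ha j).le (sub_nonneg.mpr (h j))) (Finset.mem_univ i)
  have h4 : ∑ j, a j * (⟪x, v j⟫ - c j) = -∑ j, a j * c j := by
    simp only [mul_sub, Finset.sum_sub_distrib, h0, zero_sub]
  rw [h4] at h3
  have h5 : ⟪x, v i⟫ - c i ≤ (-∑ j, a j * c j) / a i := by
    rw [le_div_iff₀ (ha i)]
    linarith
  linarith
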